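/- arXiv:2009.13400 — 3 statements merged into one kernel-verified Lean document; each statement's English description precedes it below -/
import Mathlib

section
/- Let $X$ be a real vector space, $D \subseteq X$ a convex set, and $f, g \colon D \to \mathbb{R}$. There exists a convex function $\varphi \colon D \to \mathbb{R}$ with $f \le \varphi \le g$ on $D$ if and only if for all $n \in \mathbb{N}$, all $x_0, \dots, x_n \in D$ and all $t_0, \dots, t_n \in [0,1]$ with $t_0 + \dots + t_n = 1$, one has $f\big(\sum_{k=0}^n t_k x_k\big) \le \sum_{k=0}^n t_k g(x_k)$. -/
/-- The lower boundary of a convex set in `X × ℝ` is a convex function. -/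
theorem Convex.convexOn_sInf_fiber {X : Type*} [AddCommGroup X] [Module ℝ X]
    {D : Set X} (hD : Convex ℝ D) {C : Set (X × ℝ)} (hC : Convex ℝ C)
    (hne : ∀ x ∈ D, {r : ℝ | (x, r) ∈ C}.Nonempty)
    (hbdd : ∀ x ∈ D, BddBelow {r : ℝ | (x, r) ∈ C}) :
    ConvexOn ℝ D fun x => sInf {r : ℝ | (x, r) ∈ C} := by
  refine ⟨hD, fun x hx y hy a b ha hb hab => le_of_forall_pos_le_add fun ε hε => ?_⟩
  obtain ⟨r, hr, hrlt⟩ := Real.lt_sInf_add_pos (hne x hx) hε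
  obtain ⟨s, hs, hslt⟩ := Real.lt_sInf_add_pos (hne y hy) hε
  have hmem : (a • x + b • y, a * r + b * s) ∈ C := by
    simpa using hC hr hs ha hb hab
  calc sInf {q : ℝ | (a • x + b • y, q) ∈ C}
      ≤ a * r + b * s := csInf_le (hbdd _ (hD hx hy ha hb hab)) hmem
    _ ≤ a * (sInf {q : ℝ | (x, q) ∈ C} + ε) + b * (sInf {q : ℝ | (y, q) ∈ C} + ε) := by
        gcongr
    _ = a • sInf {q : ℝ | (x, q) ∈ C} + b • sInf {q : ℝ | (y, q) ∈ C} + ε := by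
        simp only [smul_eq_mul]
        linear_combination ε * hab

/-- A Jensen-type inequality between `f` and `g` puts the convex hull of the graph of `g`
above `f`. -/
theorem le_of_mem_convexHull_graphOn {X : Type*} [AddCommGroup X] [Module ℝ X]
    {D : Set X} {f g : X → ℝ}
    (h : ∀ (n : ℕ) (x : Fin (n + 1) → X) (t : Fin (n + 1) → ℝ),
      (∀ k, x k ∈ D) → (∀ k, t k ∈ Set.Icc (0 : ℝ) 1) → (∑ k, t k) = 1 →
      f (∑ k, t k • x k) ≤ ∑ k, t k * g (x k))
    {x : X} {r : ℝ} (hr : (x, r) ∈ convexHull ℝ (D.graphOn g)) : f x ≤ r := by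
  obtain ⟨ι, _, w, z, hw, hsum, hz, hxr⟩ := mem_convexHull_iff_exists_fintype.1 hr
  have hι : Nonempty ι := by
    by_contra hempty
    rw [not_nonempty_iff] at hempty
    simp at hsum
  obtain ⟨n, hn⟩ := Nat.exists_eq_succ_of_ne_zero (Fintype.card_ne_zero (α := ι))
  let e : Fin (n + 1) ≃ ι := (Fintype.equivFinOfCardEq hn).symm
  have hzD (i : ι) : (z i).1 ∈ D ∧ g (z i).1 = (z i).2 := Set.mem_graphOn.1 (hz i)
  have key := h n (fun k => (z (e k)).1) (fun k => w (e k)) (fun k => (hzD _).1)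
    (fun k => ⟨hw _, hsum ▸ Finset.single_le_sum (fun i _ => hw i) (Finset.mem_univ _)⟩)
    ((e.sum_comp w).trans hsum)
  rw [e.sum_comp fun i => w i • (z i).1, e.sum_comp fun i => w i * g (z i).1] at key
  have hx : ∑ i, w i • (z i).1 = x := by
    simpa [Prod.fst_sum] using congrArg Prod.fst hxr
  have hr' : ∑ i, w i * g (z i).1 = r := by
    simpa [Prod.snd_sum, hzD] using congrArg Prod.snd hxr
  rwa [hx, hr'] at key

/-- Convex separation theorem of Baron, Matkowski, and Nikodem (dimension-free case):
`f` and `g` admit a convex separator on the convex set `D` iff the Jensen-type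
inequality `f (∑ tₖ xₖ) ≤ ∑ tₖ g (xₖ)` holds for all convex combinations of points of `D`. -/
theorem convex_separation_iff (X : Type*) [AddCommGroup X] [Module ℝ X]
    (D : Set X) (hD : Convex ℝ D) (f g : X → ℝ) :
    (∃ φ : X → ℝ, ConvexOn ℝ D φ ∧ ∀ x ∈ D, f x ≤ φ x ∧ φ x ≤ g x) ↔
      (∀ (n : ℕ) (x : Fin (n + 1) → X) (t : Fin (n + 1) → ℝ),
        (∀ k, x k ∈ D) → (∀ k, t k ∈ Set.Icc (0 : ℝ) 1) → (∑ k, t k) = 1 →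
        f (∑ k, t k • x k) ≤ ∑ k, t k * g (x k)) := by
  constructor
  · rintro ⟨φ, hφ, hfg⟩ n x t hx ht hsum
    calc f (∑ k, t k • x k)
        ≤ φ (∑ k, t k • x k) :=
          (hfg _ (hD.sum_mem (fun k _ => (ht k).1) hsum fun k _ => hx k)).1
      _ ≤ ∑ k, t k * φ (x k) :=
          hφ.map_sum_le (fun k _ => (ht k).1) hsum fun k _ => hx k
      _ ≤ ∑ k, t k * g (x k) :=
          Finset.sum_le_sum fun k _ => mul_le_mul_of_nonneg_left (hfg _ (hx k)).2 (ht k).1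
  · intro h
    have hmem (x : X) (hx : x ∈ D) : (x, g x) ∈ convexHull ℝ (D.graphOn g) :=
      subset_convexHull ℝ _ (Set.mem_graphOn.2 ⟨hx, rfl⟩)
    have hbdd (x : X) : BddBelow {r : ℝ | (x, r) ∈ convexHull ℝ (D.graphOn g)} :=
      ⟨f x, fun _ hr => le_of_mem_convexHull_graphOn h hr⟩
    exact ⟨fun x => sInf {r : ℝ | (x, r) ∈ convexHull ℝ (D.graphOn g)},
      hD.convexOn_sInf_fiber (convex_convexHull ℝ _) (fun x hx => ⟨g x, hmem x hx⟩)
        fun x _ => hbdd x,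
      fun x hx => ⟨le_csInf ⟨g x, hmem x hx⟩ fun _ hr => le_of_mem_convexHull_graphOn h hr,
        csInf_le (hbdd x) (hmem x hx)⟩⟩
end

section
/- Let $X$ be a finite-dimensional real vector space with $\dim X = d$, $D \subseteq X$ a convex set, and $f, g \colon D \to \mathbb{R}$. There exists a convex function $\varphi \colon D \to \mathbb{R}$ with $f \le \varphi \le g$ on $D$ if and only if for all $n \le d$, all $x_0, \dots, x_n \in D$ and all $t_0, \dots, t_n \in [0,1]$ with $t_0 + \dots + t_n = 1$, one has $f\big(\sum_{k=0}^n t_k x_k\big) \le \sum_{k=0}^n t_k g(x_k)$. -/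
open Finset Module in
/-- A linear dependence among more than `finrank ℝ X + 1` weighted points allows one of the weights
to be moved to zero, keeping the total mass and the barycenter and not increasing the cost. -/
theorem exists_reweight_eq_zero {X : Type*} [AddCommGroup X] [Module ℝ X] [FiniteDimensional ℝ X]
    (g : X → ℝ) {s : Finset X} (hs : finrank ℝ X + 1 < #s) {w : X → ℝ} (hw : ∀ x ∈ s, 0 ≤ w x) :
    ∃ z ∈ s, ∃ w' : X → ℝ, w' z = 0 ∧ (∀ x ∈ s, 0 ≤ w' x) ∧ ∑ x ∈ s, w' x = ∑ x ∈ s, w x ∧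
      ∑ x ∈ s, w' x • x = ∑ x ∈ s, w x • x ∧ ∑ x ∈ s, w' x * g x ≤ ∑ x ∈ s, w x * g x := by
  obtain ⟨l, hlx, hl, hlg, hl0⟩ : ∃ l : X → ℝ, ∑ x ∈ s, l x • x = 0 ∧ ∑ x ∈ s, l x = 0 ∧
      0 ≤ ∑ x ∈ s, l x * g x ∧ ∃ x ∈ s, l x ≠ 0 := by
    obtain ⟨l, hlx, hl, hl0⟩ := exists_nontrivial_relation_sum_zero_of_finrank_succ_lt_card hs
    rcases le_total 0 (∑ x ∈ s, l x * g x) with h | h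
    · exact ⟨l, hlx, hl, h, hl0⟩
    · exact ⟨-l, by simp [hlx], by simp [hl], by simpa using h, by simpa using hl0⟩
  have hpos : {x ∈ s | 0 < l x}.Nonempty := by
    obtain ⟨x, hx, hx0⟩ := exists_pos_of_sum_zero_of_exists_nonzero l hl hl0
    exact ⟨x, mem_filter.2 ⟨hx, hx0⟩⟩
  obtain ⟨z, hz, hmin⟩ := exists_min_image _ (fun x ↦ w x / l x) hpos
  obtain ⟨hzs, hlz⟩ := mem_filter.1 hz
  have hc : 0 ≤ w z / l z := div_nonneg (hw z hzs) hlz.le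
  refine ⟨z, hzs, fun x ↦ w x - w z / l z * l x, ?_, fun x hx ↦ ?_, ?_, ?_, ?_⟩
  · simp [hlz.ne']
  · rw [sub_nonneg]
    rcases le_or_gt (l x) 0 with h | h
    · exact (mul_nonpos_of_nonneg_of_nonpos hc h).trans (hw x hx)
    · exact (le_div_iff₀ h).1 (hmin x (mem_filter.2 ⟨hx, h⟩))
  · simp [← mul_sum, hl]
  · simp [sub_smul, mul_smul, ← smul_sum, hlx]
  · simp only [sub_mul, mul_assoc, sum_sub_distrib, ← mul_sum]
    linarith [mul_nonneg hc hlg]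

theorem sum_comp_coe_equiv {ι α M : Type*} [Fintype ι] [AddCommMonoid M] {s : Finset α}
    (e : ι ≃ s) (F : α → M) : ∑ k, F (e k) = ∑ x ∈ s, F x := by
  rw [e.sum_comp (fun x : s ↦ F x), Finset.sum_coe_sort]

open Finset Module in
/-- The Jensen-type inequality for at most `finrank ℝ X + 1` points implies it for arbitrary finite
convex combinations. -/
theorem le_sum_of_le_sum_card_le {X : Type*} [AddCommGroup X] [Module ℝ X] [FiniteDimensional ℝ X]
    {D : Set X} {f g : X → ℝ}
    (h : ∀ n ≤ finrank ℝ X, ∀ (x : Fin (n + 1) → X) (t : Fin (n + 1) → ℝ),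
      (∀ k, x k ∈ D) → (∀ k, t k ∈ Set.Icc (0 : ℝ) 1) → (∑ k, t k) = 1 →
      f (∑ k, t k • x k) ≤ ∑ k, t k * g (x k))
    (s : Finset X) (hs : ∀ x ∈ s, x ∈ D) (w : X → ℝ) (hw : ∀ x ∈ s, 0 ≤ w x)
    (hw1 : ∑ x ∈ s, w x = 1) : f (∑ x ∈ s, w x • x) ≤ ∑ x ∈ s, w x * g x := by
  classical
  induction s using Finset.strongInduction generalizing w with
  | H s ih =>
    rcases lt_or_ge (finrank ℝ X + 1) #s with hcard | hcard
    · obtain ⟨z, hz, w', hz0, hw', hsum, hbary, hcost⟩ := exists_reweight_eq_zero g hcard hw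
      have key := ih (s.erase z) (erase_ssubset hz) (fun x hx ↦ hs x (mem_of_mem_erase hx)) w'
        (fun x hx ↦ hw' x (mem_of_mem_erase hx)) (by rw [sum_erase _ hz0, hsum, hw1])
      rw [sum_erase _ (by simp [hz0]), sum_erase _ (by simp [hz0]), hbary] at key
      exact key.trans hcost
    · have hne : s.Nonempty := nonempty_of_sum_ne_zero (hw1.trans_ne one_ne_zero)
      obtain ⟨n, hn⟩ := Nat.exists_eq_add_one_of_ne_zero hne.card_pos.ne'
      let e := (s.equivFinOfCardEq hn).symm
      have key := h n (by lia) (fun k ↦ e k) (fun k ↦ w (e k)) (fun k ↦ hs _ (e k).2)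
        (fun k ↦ ⟨hw _ (e k).2, hw1 ▸ single_le_sum hw (e k).2⟩) (by rw [sum_comp_coe_equiv e w, hw1])
      rwa [sum_comp_coe_equiv e (fun x ↦ w x • x),
        sum_comp_coe_equiv e (fun x ↦ w x * g x)] at key

/-- The costs of the finite convex combinations of points of `D` representing `x`. -/
def convexCombinationCosts {X : Type*} [AddCommGroup X] [Module ℝ X] (D : Set X) (g : X → ℝ)
    (x : X) : Set ℝ :=
  {c | ∃ w : X →₀ ℝ, (∀ y, 0 ≤ w y) ∧ (∀ y ∈ w.support, y ∈ D) ∧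
    Finsupp.linearCombination ℝ (fun _ ↦ (1 : ℝ)) w = 1 ∧
    Finsupp.linearCombination ℝ id w = x ∧ Finsupp.linearCombination ℝ g w = c}

theorem self_mem_convexCombinationCosts {X : Type*} [AddCommGroup X] [Module ℝ X] {D : Set X}
    (g : X → ℝ) {x : X} (hx : x ∈ D) : g x ∈ convexCombinationCosts D g x := by
  classical
  refine ⟨Finsupp.single x 1, fun y ↦ ?_, fun y hy ↦ ?_, by simp, by simp, by simp⟩
  · rw [Finsupp.single_apply]
    split_ifs <;> norm_num
  · rwa [Finset.mem_singleton.1 (Finsupp.support_single_subset hy)]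

theorem combo_mem_convexCombinationCosts {X : Type*} [AddCommGroup X] [Module ℝ X] {D : Set X}
    {g : X → ℝ} {x y : X} {a b c c' : ℝ} (ha : 0 ≤ a) (hb : 0 ≤ b) (hab : a + b = 1)
    (hc : c ∈ convexCombinationCosts D g x) (hc' : c' ∈ convexCombinationCosts D g y) :
    a * c + b * c' ∈ convexCombinationCosts D g (a • x + b • y) := by
  classical
  obtain ⟨w, hw, hwD, hw1, rfl, rfl⟩ := hc
  obtain ⟨v, hv, hvD, hv1, rfl, rfl⟩ := hc'
  refine ⟨a • w + b • v, fun z ↦ ?_, fun z hz ↦ ?_, ?_, ?_, ?_⟩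
  · exact add_nonneg (mul_nonneg ha (hw z)) (mul_nonneg hb (hv z))
  · rcases Finset.mem_union.1 (Finsupp.support_add hz) with h | h
    · exact hwD z (Finsupp.support_smul h)
    · exact hvD z (Finsupp.support_smul h)
  · rw [map_add, map_smul, map_smul, hw1, hv1]
    simpa using hab
  · simp only [map_add, map_smul]
  · simp only [map_add, map_smul, smul_eq_mul]

/-- If the costs are bounded below, their infimum is a convex function. -/
theorem convexOn_sInf_convexCombinationCosts {X : Type*} [AddCommGroup X] [Module ℝ X] {D : Set X}
    (hD : Convex ℝ D) {g : X → ℝ} (hbdd : ∀ x, BddBelow (convexCombinationCosts D g x)) :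
    ConvexOn ℝ D fun x ↦ sInf (convexCombinationCosts D g x) := by
  refine ⟨hD, fun x hx y hy a b ha hb hab ↦ le_of_forall_pos_lt_add fun ε hε ↦ ?_⟩
  obtain ⟨c, hc, hcε⟩ := Real.lt_sInf_add_pos ⟨_, self_mem_convexCombinationCosts g hx⟩ hε
  obtain ⟨c', hc', hcε'⟩ := Real.lt_sInf_add_pos ⟨_, self_mem_convexCombinationCosts g hy⟩ hε
  refine (csInf_le (hbdd _) (combo_mem_convexCombinationCosts ha hb hab hc hc')).trans_lt ?_
  simp only [smul_eq_mul]
  obtain rfl : b = 1 - a := by linarith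
  rcases ha.eq_or_lt with rfl | ha
  · linarith
  · linarith [mul_lt_mul_of_pos_left hcε ha, mul_le_mul_of_nonneg_left hcε'.le hb]


/-- Convex separation theorem of Baron, Matkowski, and Nikodem (finite-dimensional case):
if `dim X = d`, then `f` and `g` admit a convex separator on the convex set `D` iff the
Jensen-type inequality holds for all convex combinations of at most `d + 1` points of `D`. -/
theorem convex_separation_iff_findim (X : Type*) [AddCommGroup X] [Module ℝ X]
    [FiniteDimensional ℝ X] (d : ℕ) (hd : Module.finrank ℝ X = d)
    (D : Set X) (hD : Convex ℝ D) (f g : X → ℝ) :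
    (∃ φ : X → ℝ, ConvexOn ℝ D φ ∧ ∀ x ∈ D, f x ≤ φ x ∧ φ x ≤ g x) ↔
      (∀ n ≤ d, ∀ (x : Fin (n + 1) → X) (t : Fin (n + 1) → ℝ),
        (∀ k, x k ∈ D) → (∀ k, t k ∈ Set.Icc (0 : ℝ) 1) → (∑ k, t k) = 1 →
        f (∑ k, t k • x k) ≤ ∑ k, t k * g (x k)) := by
  subst hd
  constructor
  · rintro ⟨φ, hφ, hfg⟩ n - x t hx ht ht1
    have ht0 : ∀ k ∈ Finset.univ, 0 ≤ t k := fun k _ ↦ (ht k).1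
    calc f (∑ k, t k • x k) ≤ φ (∑ k, t k • x k) :=
          (hfg _ (hD.sum_mem ht0 ht1 fun k _ ↦ hx k)).1
      _ ≤ ∑ k, t k * φ (x k) := hφ.map_sum_le ht0 ht1 fun k _ ↦ hx k
      _ ≤ ∑ k, t k * g (x k) :=
          Finset.sum_le_sum fun k hk ↦ mul_le_mul_of_nonneg_left (hfg _ (hx k)).2 (ht0 k hk)
  · intro h
    have hlb : ∀ x, ∀ c ∈ convexCombinationCosts D g x, f x ≤ c := by
      rintro _ _ ⟨w, hw, hwD, hw1, rfl, rfl⟩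
      simp only [Finsupp.linearCombination_apply, Finsupp.sum, smul_eq_mul, mul_one, id] at hw1 ⊢
      exact le_sum_of_le_sum_card_le h w.support hwD w (fun x _ ↦ hw x) hw1
    have hbdd : ∀ x, BddBelow (convexCombinationCosts D g x) := fun x ↦ ⟨f x, hlb x⟩
    exact ⟨_, convexOn_sInf_convexCombinationCosts hD hbdd, fun x hx ↦
      have hgx := self_mem_convexCombinationCosts g hx
      ⟨le_csInf ⟨_, hgx⟩ (hlb x), csInf_le (hbdd x) hgx⟩⟩
end

section
/- Let $X$ be a real vector space, $D \subseteq X$ a convex set, and $f, g \colon D \to \mathbb{R}$. Suppose that for all $n \in \mathbb{N}$, all $x_0, x_1, \dots, x_n \in D$, all $x \in \operatorname{conv}\{x_1, \dots, x_n\}$, and all $t \in [0,1]$, one has $f((1-t)x_0 + tx) \le (1-t)g(x_0) + t f(x)$. Then for all $n \in \mathbb{N}$, all $x_0, \dots, x_n \in D$ and all $t_0, \dots, t_n \in [0,1]$ with $t_0 + \dots + t_n = 1$, one has $f\big(\sum_{k=0}^n t_k x_k\big) \le \sum_{k=0}^n t_k g(x_k)$. -/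
/-- The segment-type inequality of the paper implies the Jensen-type inequality of
Baron, Matkowski, and Nikodem. -/
theorem segment_ineq_imp_jensen_ineq (X : Type*) [AddCommGroup X] [Module ℝ X]
    (D : Set X) (hD : Convex ℝ D) (f g : X → ℝ)
    (h : ∀ (n : ℕ) (x₀ : X), x₀ ∈ D → ∀ xs : Fin n → X, (∀ k, xs k ∈ D) →
      ∀ x ∈ convexHull ℝ (Set.range xs), ∀ t ∈ Set.Icc (0 : ℝ) 1,
      f ((1 - t) • x₀ + t • x) ≤ (1 - t) * g x₀ + t * f x) :
    ∀ (n : ℕ) (x : Fin (n + 1) → X) (t : Fin (n + 1) → ℝ),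
      (∀ k, x k ∈ D) → (∀ k, t k ∈ Set.Icc (0 : ℝ) 1) → (∑ k, t k) = 1 →
      f (∑ k, t k • x k) ≤ ∑ k, t k * g (x k) := by
  
  have segment : ∀ a ∈ D, ∀ b ∈ D, ∀ t ∈ Set.Icc (0 : ℝ) 1,
      f ((1 - t) • a + t • b) ≤ (1 - t) * g a + t * f b := fun a ha b hb t ht =>
    h 1 a ha (fun _ => b) (fun _ => hb) b (subset_convexHull ℝ _ ⟨0, rfl⟩) t ht
  have le_of_mem : ∀ a ∈ D, f a ≤ g a := fun a ha => by
    simpa using segment a ha a ha 0 (by simp)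
  intro n
  induction n with
  | zero =>
    intro x t hx _ hsum
    have ht : t 0 = 1 := by simpa using hsum
    simpa [ht] using le_of_mem (x 0) (hx 0)
  | succ n ih =>
    intro x t hx ht hsum
    rw [Fin.sum_univ_succ] at hsum
    rw [Fin.sum_univ_succ, Fin.sum_univ_succ (fun k => t k * g (x k))]
    have tail_nonneg : ∀ k ∈ Finset.univ, 0 ≤ t (Fin.succ k) := fun k _ => (ht k.succ).1
    set s := ∑ k : Fin (n + 1), t k.succ with hs
    have ht0 : t 0 = 1 - s := by linarith
    have hs_nonneg : 0 ≤ s := Finset.sum_nonneg tail_nonneg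
    rcases hs_nonneg.eq_or_lt with hs0 | hs_pos
    · have tail_zero : ∀ k : Fin (n + 1), t k.succ = 0 := fun k =>
        (Finset.sum_eq_zero_iff_of_nonneg tail_nonneg).1 (hs.symm.trans hs0.symm) k
          (Finset.mem_univ k)
      simpa [ht0, ← hs0, tail_zero] using le_of_mem (x 0) (hx 0)
    · have weight_nonneg : ∀ k : Fin (n + 1), 0 ≤ s⁻¹ * t k.succ := fun k =>
        mul_nonneg (inv_nonneg.2 hs_nonneg) (ht k.succ).1
      have weight_sum : ∑ k : Fin (n + 1), s⁻¹ * t k.succ = 1 := by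
        rw [← Finset.mul_sum, ← hs, inv_mul_cancel₀ hs_pos.ne']
      have weight_mem : ∀ k : Fin (n + 1), s⁻¹ * t k.succ ∈ Set.Icc (0 : ℝ) 1 := fun k =>
        ⟨weight_nonneg k, weight_sum ▸ Finset.single_le_sum
          (f := fun k : Fin (n + 1) => s⁻¹ * t k.succ)
          (fun j _ => weight_nonneg j) (Finset.mem_univ k)⟩
      have mean_mem : ∑ k : Fin (n + 1), (s⁻¹ * t k.succ) • x k.succ ∈ D :=
        hD.sum_mem (fun k _ => weight_nonneg k) weight_sum fun k _ => hx k.succ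
      have mean_le := ih (fun k => x k.succ) (fun k => s⁻¹ * t k.succ)
        (fun k => hx k.succ) weight_mem weight_sum
      have segment_le := segment (x 0) (hx 0) _ mean_mem s
        ⟨hs_nonneg, by linarith [(ht 0).1]⟩
      have smul_mean : s • ∑ k : Fin (n + 1), (s⁻¹ * t k.succ) • x k.succ
          = ∑ k : Fin (n + 1), t k.succ • x k.succ := by
        simp only [Finset.smul_sum, smul_smul, mul_inv_cancel_left₀ hs_pos.ne']
      have mul_mean : s * ∑ k : Fin (n + 1), s⁻¹ * t k.succ * g (x k.succ)
          = ∑ k : Fin (n + 1), t k.succ * g (x k.succ) := by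
        simp only [Finset.mul_sum, mul_assoc, mul_inv_cancel_left₀ hs_pos.ne']
      rw [smul_mean] at segment_le
      rw [ht0, ← mul_mean]
      exact segment_le.trans (by gcongr)
end
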